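/- Let ρ be a law invariant risk measure with induced divergence α. Let E and F be Polish spaces and K a kernel from E to F. Then α(νK | μK) ≤ α(ν | μ) for all μ, ν ∈ 𝓟(E). In particular, α(ν∘T⁻¹ | μ∘T⁻¹) ≤ α(ν | μ) for every measurable T : E → F, with equality when T is a bijection with measurable inverse. -/

import Mathlib

open MeasureTheory ProbabilityTheory Filter Topology
open scoped ENNReal NNReal

noncomputable section

namespace RiskDiv

/-- A bounded measurable real-valued function (a representative of an element of `L^∞`). -/
def BddMeas {E : Type*} [MeasurableSpace E] (f : E → ℝ) : Prop :=
  Measurable f ∧ ∃ M : ℝ, ∀ x, |f x| ≤ M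

/-- A (normalized, convex, monotone, cash-additive) risk measure on `L^∞(E, μ)`,
viewed as a functional on bounded measurable functions which respects a.e. equality. -/
structure IsRiskMeasure {E : Type*} [MeasurableSpace E] (μ : Measure E)
    (ρ : (E → ℝ) → ℝ) : Prop where
  mono : ∀ f g : E → ℝ, BddMeas f → BddMeas g → (∀ᵐ x ∂μ, f x ≤ g x) → ρ f ≤ ρ g
  cash : ∀ (f : E → ℝ) (c : ℝ), BddMeas f → ρ (fun x => f x + c) = ρ f + c
  norm0 : ρ (fun _ => 0) = 0
  cvx : ∀ (f g : E → ℝ) (t : ℝ), BddMeas f → BddMeas g → 0 ≤ t → t ≤ 1 →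
    ρ (fun x => t * f x + (1 - t) * g x) ≤ t * ρ f + (1 - t) * ρ g
  congr_ae : ∀ f g : E → ℝ, BddMeas f → BddMeas g → (∀ᵐ x ∂μ, f x = g x) → ρ f = ρ g

/-- Law invariance: `ρ` only depends on the distribution of its argument. -/
def LawInvariant {E : Type*} [MeasurableSpace E] (μ : Measure E) (ρ : (E → ℝ) → ℝ) : Prop :=
  ∀ f g : E → ℝ, BddMeas f → BddMeas g → μ.map f = μ.map g → ρ f = ρ g

open Classical in
/-- `ρ_μ(f) := ρ(f ∘ X)` where `X` is any random variable with law `μ` (this is well defined,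
independently of the choice of `X`, when `ρ` is law invariant). -/
def rhoMu {Ω : Type*} [MeasurableSpace Ω] (P : Measure Ω) (ρ : (Ω → ℝ) → ℝ)
    {E : Type*} [MeasurableSpace E] (μ : Measure E) (f : E → ℝ) : ℝ :=
  if h : ∃ X : Ω → E, Measurable X ∧ P.map X = μ then ρ (f ∘ h.choose) else 0

/-- The divergence induced by `ρ`:
`α(ν|μ) := sup { ∫ f dν − ρ_μ(f) : f bounded measurable } ∈ [0,∞]`. -/
def divergence {Ω : Type*} [MeasurableSpace Ω] (P : Measure Ω) (ρ : (Ω → ℝ) → ℝ)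
    {E : Type*} [MeasurableSpace E] (ν μ : Measure E) : ℝ≥0∞ :=
  ⨆ (f : E → ℝ) (_ : BddMeas f), ENNReal.ofReal ((∫ x, f x ∂ν) - rhoMu P ρ μ f)

/-- The divergence induced by `ρ` is simplified if, on `[0,1]`, the supremum defining it can be
restricted to continuous functions. -/
def Simplified {Ω : Type*} [MeasurableSpace Ω] (P : Measure Ω) (ρ : (Ω → ℝ) → ℝ) : Prop :=
  ∀ μ ν : Measure (Set.Icc (0:ℝ) 1), IsProbabilityMeasure μ → IsProbabilityMeasure ν →
    divergence P ρ ν μ =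
      ⨆ (f : (Set.Icc (0:ℝ) 1) → ℝ) (_ : Continuous f),
        ENNReal.ofReal ((∫ x, f x ∂ν) - rhoMu P ρ μ f)


theorem exists_uniform {Ω : Type*} [MeasurableSpace Ω] [StandardBorelSpace Ω]
    (P : Measure Ω) [IsProbabilityMeasure P] [NullSingletonClass P] :
    ∃ U : Ω → unitInterval, Measurable U ∧ P.map U = volume := by
  have he := measurableEmbedding_embeddingReal Ω
  set e := embeddingReal Ω with hedef
  set L : Measure ℝ := P.map e with hL
  haveI : IsProbabilityMeasure L := Measure.isProbabilityMeasure_map he.measurable.aemeasurable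
  have hat : ∀ x, L {x} = 0 := by
    intro x
    rw [hL, Measure.map_apply he.measurable (measurableSet_singleton x)]
    have hs : (e ⁻¹' {x}).Subsingleton := by
      intro a ha b hb
      exact he.injective (ha.trans hb.symm)
    exact hs.measure_zero P
  have hcont : Continuous (cdf L) := by
    rw [continuous_iff_continuousAt]
    intro x
    rw [(monotone_cdf L).continuousAt_iff_leftLim_eq_rightLim, StieltjesFunction.rightLim_eq]
    have h := StieltjesFunction.measure_singleton (cdf L) x
    rw [measure_cdf, hat, eq_comm, ENNReal.ofReal_eq_zero] at h
    exact le_antisymm ((monotone_cdf L).leftLim_le le_rfl) (by linarith)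
  let V : ℝ → unitInterval := fun x => ⟨cdf L x, cdf_nonneg L x, cdf_le_one L x⟩
  have hV : Measurable V := (monotone_cdf L).measurable.subtype_mk
  refine ⟨fun ω => V (e ω), hV.comp he.measurable, ?_⟩
  have : P.map (fun ω => V (e ω)) = L.map V := by
    rw [hL, Measure.map_map hV he.measurable]; rfl
  rw [this]
  haveI : IsProbabilityMeasure (L.map V) := Measure.isProbabilityMeasure_map hV.aemeasurable
  refine Measure.ext_of_Iic _ _ fun t => ?_
  rw [Measure.map_apply hV measurableSet_Iic, unitInterval.volume_Iic]
  have hset : V ⁻¹' Set.Iic t = {x | cdf L x ≤ t} := by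
    ext x; rfl
  rw [hset]
  rcases eq_or_lt_of_le t.2.2 with h1 | h1
  · have : {x | cdf L x ≤ t} = Set.univ := by
      ext x; simp only [Set.mem_setOf_eq, Set.mem_univ, iff_true]
      rw [h1]; exact cdf_le_one L x
    rw [this, h1]; simp
  · rcases Set.eq_empty_or_nonempty {x | cdf L x ≤ t} with h | h
    · rw [h]
      rcases eq_or_lt_of_le t.2.1 with h0 | h0
      · rw [← h0]; simp
      · exfalso
        obtain ⟨x, hx⟩ := ((tendsto_cdf_atBot L).eventually (gt_mem_nhds h0)).exists
        have : x ∈ {x | cdf L x ≤ t} := le_of_lt hx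
        rw [h] at this; exact this
    · have hb : BddAbove {x | cdf L x ≤ t} := by
        obtain ⟨y, hy⟩ := ((tendsto_cdf_atTop L).eventually (lt_mem_nhds h1)).exists
        refine ⟨y, fun x hx => ?_⟩
        by_contra hc
        push Not at hc
        have := monotone_cdf L hc.le
        have hx' : cdf L x ≤ t := hx
        linarith
      have hc : IsClosed {x | cdf L x ≤ t} := isClosed_le hcont continuous_const
      have hs := hc.csSup_mem h hb
      set s := sSup {x | cdf L x ≤ t} with hsdef
      have heq : {x | cdf L x ≤ t} = Set.Iic s := by
        ext x
        refine ⟨fun hx => le_csSup hb hx, fun hx => ?_⟩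
        exact (monotone_cdf L hx).trans hs
      have hst : cdf L s = t := by
        refine le_antisymm hs ?_
        by_contra hlt
        push Not at hlt
        have h2 : ∀ᶠ y in 𝓝[>] s, cdf L y < t :=
          (hcont.continuousAt.eventually (gt_mem_nhds hlt)).filter_mono nhdsWithin_le_nhds
        obtain ⟨y, hy1, hy2⟩ := (h2.and self_mem_nhdsWithin).exists
        exact absurd (le_csSup hb (show y ∈ {x | cdf L x ≤ t} from hy1.le)) (not_le.2 hy2)
      rw [heq, ← ofReal_cdf, hst]

theorem exists_law {Ω : Type*} [MeasurableSpace Ω] [StandardBorelSpace Ω]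
    (P : Measure Ω) [IsProbabilityMeasure P] [NullSingletonClass P]
    {Y : Type*} [MeasurableSpace Y] [StandardBorelSpace Y] (m : Measure Y)
    [IsProbabilityMeasure m] : ∃ X : Ω → Y, Measurable X ∧ P.map X = m := by
  haveI : Nonempty Y := nonempty_of_isProbabilityMeasure m
  obtain ⟨U, hU, hUP⟩ := exists_uniform P
  obtain ⟨f, hf, hfm⟩ := m.exists_measurable_map_eq
  exact ⟨f ∘ U, hf.comp hU, by rw [← Measure.map_map hf hU, hUP, hfm]⟩

theorem BddMeas.comp {E G : Type*} [MeasurableSpace E] [MeasurableSpace G] {f : E → ℝ}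
    (hf : BddMeas f) {X : G → E} (hX : Measurable X) : BddMeas (f ∘ X) :=
  ⟨hf.1.comp hX, hf.2.imp fun _ h x => h (X x)⟩

theorem rhoMu_eq {Ω : Type*} [MeasurableSpace Ω] {P : Measure Ω} {ρ : (Ω → ℝ) → ℝ}
    (hLI : LawInvariant P ρ) {E : Type*} [MeasurableSpace E] {μ : Measure E} {f : E → ℝ}
    (hf : BddMeas f) {X : Ω → E} (hX : Measurable X) (hXm : P.map X = μ) :
    rhoMu P ρ μ f = ρ (f ∘ X) := by
  have h : ∃ X : Ω → E, Measurable X ∧ P.map X = μ := ⟨X, hX, hXm⟩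
  unfold rhoMu
  rw [dif_pos h]
  apply hLI _ _ (hf.comp h.choose_spec.1) (hf.comp hX)
  rw [← Measure.map_map hf.1 h.choose_spec.1, ← Measure.map_map hf.1 hX, h.choose_spec.2, hXm]

theorem rho_avg {Ω : Type*} [MeasurableSpace Ω] {P : Measure Ω} {ρ : (Ω → ℝ) → ℝ}
    (hρ : IsRiskMeasure P ρ) {M : ℝ} (Z : ℕ → Ω → ℝ) (hm : ∀ i, Measurable (Z i))
    (hM : ∀ i ω, |Z i ω| ≤ M) (c : ℝ) (hc : ∀ i, ρ (Z i) ≤ c) (n : ℕ) :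
    BddMeas (fun ω => (∑ i ∈ Finset.range (n+1), Z i ω) / (n+1 : ℝ)) ∧
    ρ (fun ω => (∑ i ∈ Finset.range (n+1), Z i ω) / (n+1 : ℝ)) ≤ c := by
  have hB : ∀ n : ℕ, BddMeas (fun ω => (∑ i ∈ Finset.range (n+1), Z i ω) / (n+1 : ℝ)) := by
    intro n
    refine ⟨by fun_prop, M, fun ω => ?_⟩
    have hpos : (0:ℝ) < n + 1 := by positivity
    rw [abs_div, abs_of_pos hpos, div_le_iff₀ hpos]
    calc _ ≤ ∑ i ∈ Finset.range (n+1), |Z i ω| := Finset.abs_sum_le_sum_abs _ _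
      _ ≤ ∑ i ∈ Finset.range (n+1), M := Finset.sum_le_sum fun i _ => hM i ω
      _ = M * (n+1) := by simp; ring
  refine ⟨hB n, ?_⟩
  induction n with
  | zero => simpa using hc 0
  | succ n ih =>
    have hpos : (0:ℝ) < n + 1 + 1 := by positivity
    have ht1 : (1:ℝ) / (n+1+1) ≤ 1 := by
      rw [div_le_one hpos]; linarith [(Nat.cast_nonneg n : (0:ℝ) ≤ n)]
    have h := hρ.cvx (Z (n+1)) _ (1/(n+1+1)) ⟨hm _, M, hM _⟩ (hB n) (by positivity) ht1
    have heq : (fun ω => (∑ i ∈ Finset.range (n+1+1), Z i ω) / ((n+1 : ℕ) +1 : ℝ)) =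
        fun ω => (1/(n+1+1)) * Z (n+1) ω + (1 - 1/(n+1+1)) *
          ((∑ i ∈ Finset.range (n+1), Z i ω) / (n+1 : ℝ)) := by
      funext ω
      rw [Finset.sum_range_succ]
      push_cast
      field_simp
      ring
    rw [heq]
    refine h.trans ?_
    have h1 : 1/((n:ℝ)+1+1) * ρ (Z (n+1)) ≤ 1/((n:ℝ)+1+1) * c :=
      mul_le_mul_of_nonneg_left (hc _) (by positivity)
    have h2 := mul_le_mul_of_nonneg_left ih (sub_nonneg.2 ht1)
    linarith

/-- Representative in `(0,1]` of a point of the unit circle. -/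
def hrep (a : UnitAddCircle) : ℝ := (AddCircle.equivIoc (1:ℝ) 0 a : ℝ)

theorem hrep_mem (a : UnitAddCircle) : hrep a ∈ Set.Ioc (0:ℝ) 1 := by
  have := (AddCircle.equivIoc (1:ℝ) 0 a).2
  simpa [hrep] using this

theorem hrep_coe {x : ℝ} (hx : x ∈ Set.Ioc (0:ℝ) 1) : hrep (x : UnitAddCircle) = x := by
  unfold hrep
  rw [AddCircle.equivIoc_coe_eq (by simpa using hx)]

theorem coe_hrep (a : UnitAddCircle) : ((hrep a : ℝ) : UnitAddCircle) = a :=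
  AddCircle.coe_equivIoc

theorem hrep_measurable : Measurable hrep :=
  measurable_subtype_coe.comp (AddCircle.measurableEquivIoc (1:ℝ) 0).measurable

theorem hrep_vol {s : ℝ} (h0 : 0 ≤ s) (h1 : s ≤ 1) :
    (volume : Measure UnitAddCircle) {a | hrep a ≤ s} = ENNReal.ofReal s := by
  have hm : MeasurableSet {a | hrep a ≤ s} := hrep_measurable measurableSet_Iic
  rw [AddCircle.add_projection_respects_measure 1 0 hm]
  have : (QuotientAddGroup.mk ⁻¹' {a : UnitAddCircle | hrep a ≤ s} ∩ Set.Ioc (0:ℝ) (0+1))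
      = Set.Ioc 0 s := by
    ext x
    simp only [Set.mem_inter_iff, Set.mem_preimage, Set.mem_Ioc, zero_add]
    constructor
    · rintro ⟨h2, h3⟩
      have h2' : hrep (x : UnitAddCircle) ≤ s := h2
      rw [hrep_coe h3] at h2'
      exact ⟨h3.1, h2'⟩
    · rintro ⟨h2, h3⟩
      refine ⟨?_, h2, h3.trans h1⟩
      change hrep (x : UnitAddCircle) ≤ s
      rwa [hrep_coe ⟨h2, h3.trans h1⟩]
  rw [this]; simp

/-- Sum over the `n+1` equally spaced translates. -/
def circSum (q : ℝ → ℝ) (n : ℕ) (a : UnitAddCircle) : ℝ :=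
  ∑ i ∈ Finset.range (n+1), q (hrep (a + (((i:ℝ) / (n+1) : ℝ) : UnitAddCircle)))

theorem circSum_shift (q : ℝ → ℝ) (n : ℕ) (a : UnitAddCircle) :
    circSum q n (a + (((1:ℝ) / (n+1) : ℝ) : UnitAddCircle)) = circSum q n a := by
  unfold circSum
  have h : ∀ i : ℕ, a + (((1:ℝ) / (n+1) : ℝ) : UnitAddCircle) + (((i:ℝ) / (n+1) : ℝ) : UnitAddCircle)
      = a + ((((i+1 : ℕ):ℝ) / (n+1) : ℝ) : UnitAddCircle) := by
    intro i
    rw [add_assoc, ← AddCircle.coe_add]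
    congr 2
    push_cast; ring
  simp_rw [h]
  rw [Finset.sum_range_succ, Finset.sum_range_succ' (fun i : ℕ =>
    q (hrep (a + (((i:ℝ) / (n+1) : ℝ) : UnitAddCircle))))]
  congr 3
  have : (((n+1 : ℕ):ℝ) / (n+1) : ℝ) = 1 := by
    push_cast; field_simp
  rw [this]
  simp

theorem circSum_rep (q : ℝ → ℝ) (n : ℕ) (a : UnitAddCircle) :
    ∃ v : ℝ, 0 < v ∧ v ≤ 1 / (n+1) ∧
      circSum q n a = ∑ i ∈ Finset.range (n+1), q (v + (i:ℝ) / (n+1)) := by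
  have hpos : (0:ℝ) < n + 1 := by positivity
  have key : ∀ k : ℕ, ∀ r : ℝ, circSum q n ((r + (k:ℝ)/(n+1) : ℝ) : UnitAddCircle) =
      circSum q n (r : UnitAddCircle) := by
    intro k
    induction k with
    | zero => intro r; simp
    | succ k ih =>
      intro r
      rw [← ih r, ← circSum_shift q n ((r + (k:ℝ)/(n+1) : ℝ) : UnitAddCircle), ← AddCircle.coe_add]
      congr 2
      push_cast; ring
  obtain ⟨hr0, hr1⟩ := hrep_mem a
  set r := hrep a with hr
  have hc : 0 < ⌈r * (n+1)⌉₊ := Nat.ceil_pos.2 (by positivity)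
  obtain ⟨k, hk⟩ := Nat.exists_eq_succ_of_ne_zero hc.ne'
  have h1 : r * (n+1) ≤ k + 1 := by
    have := Nat.le_ceil (r * (n+1 : ℝ)); rw [hk] at this; push_cast at this; exact this
  have h2 : (k:ℝ) < r * (n+1) := by
    have := Nat.ceil_lt_add_one (show 0 ≤ r * (n+1 : ℝ) by positivity)
    rw [hk] at this; push_cast at this; linarith
  have hv0 : 0 < r - k/(n+1) := by
    rw [sub_pos, div_lt_iff₀ hpos]; exact h2
  have hv1 : r - k/(n+1) ≤ 1/(n+1) := by
    rw [sub_le_iff_le_add, ← add_div, le_div_iff₀ hpos]; linarith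
  refine ⟨r - k/(n+1), hv0, hv1, ?_⟩
  have h3 : a = ((r - k/(n+1) + (k:ℝ)/(n+1) : ℝ) : UnitAddCircle) := by
    rw [sub_add_cancel, hr, coe_hrep]
  rw [h3, key]
  unfold circSum
  refine Finset.sum_congr rfl fun i hi => ?_
  rw [← AddCircle.coe_add, hrep_coe]
  have hi' : (i:ℝ) ≤ n := by exact_mod_cast Nat.lt_succ_iff.1 (Finset.mem_range.1 hi)
  refine ⟨by positivity, ?_⟩
  have : (i:ℝ)/(n+1) ≤ n/(n+1) := by gcongr
  have h5 : (n:ℝ)/(n+1) + 1/(n+1) = 1 := by field_simp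
  linarith

theorem circSum_le {q : ℝ → ℝ} {M : ℝ} (hq : MonotoneOn q (Set.Ioc 0 1))
    (hM : ∀ u ∈ Set.Ioc (0:ℝ) 1, |q u| ≤ M) (n : ℕ) (a b : UnitAddCircle) :
    circSum q n a ≤ circSum q n b + 2 * M := by
  obtain ⟨v, hv0, hv1, hv⟩ := circSum_rep q n a
  obtain ⟨w, hw0, hw1, hw⟩ := circSum_rep q n b
  have hmem : ∀ z : ℝ, 0 < z → z ≤ 1/(n+1) → ∀ i : ℕ, i ≤ n → z + (i:ℝ)/(n+1) ∈ Set.Ioc (0:ℝ) 1 := by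
    intro z hz0 hz1 i hi
    have hi' : (i:ℝ) ≤ n := by exact_mod_cast hi
    refine ⟨by positivity, ?_⟩
    have : (i:ℝ)/(n+1) ≤ n/(n+1) := by gcongr
    have h5 : (n:ℝ)/(n+1) + 1/(n+1) = 1 := by field_simp
    linarith
  rw [hv, hw, Finset.sum_range_succ, Finset.sum_range_succ']
  have h1 : ∑ i ∈ Finset.range n, q (v + (i:ℝ)/(n+1)) ≤
      ∑ i ∈ Finset.range n, q (w + ((i+1 : ℕ):ℝ)/(n+1)) := by
    refine Finset.sum_le_sum fun i hi => ?_
    have hi' := Finset.mem_range.1 hi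
    refine hq (hmem v hv0 hv1 i hi'.le) (hmem w hw0 hw1 (i+1) hi') ?_
    push_cast
    rw [add_div]; linarith
  have h2 := (abs_le.1 (hM _ (hmem v hv0 hv1 n le_rfl))).2
  have h3 := (abs_le.1 (hM _ (hmem w hw0 hw1 0 (Nat.zero_le _)))).1
  linarith

/-- Quantile function. -/
def quant (m : Measure ℝ) (u : ℝ) : ℝ := sInf {t | u ≤ cdf m t}

section quant
variable {m : Measure ℝ} [IsProbabilityMeasure m] {M : ℝ}

theorem quant_set (hM : m (Set.Icc (-M) M)ᶜ = 0) {u : ℝ} (hu : u ∈ Set.Ioc (0:ℝ) 1) :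
    M ∈ {t | u ≤ cdf m t} ∧ ∀ t ∈ {t | u ≤ cdf m t}, -M ≤ t := by
  constructor
  · have : m (Set.Iic M) = 1 := by
      rw [prob_compl_eq_zero_iff measurableSet_Icc] at hM
      refine le_antisymm prob_le_one ?_
      rw [← hM]
      exact measure_mono Set.Icc_subset_Iic_self
    have h : cdf m M = 1 := by rw [cdf_eq_real, Measure.real, this]; simp
    change u ≤ cdf m M
    rw [h]; exact hu.2
  · intro t ht
    by_contra hlt
    push Not at hlt
    have : m (Set.Iic t) = 0 := by
      refine measure_mono_null ?_ hM
      intro x hx hx2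
      exact absurd (hx2.1.trans hx) (not_le.2 hlt)
    have h : cdf m t = 0 := by rw [cdf_eq_real, Measure.real, this]; simp
    have ht' : u ≤ cdf m t := ht
    linarith [hu.1]

theorem quant_le_iff (hM : m (Set.Icc (-M) M)ᶜ = 0) {u : ℝ} (hu : u ∈ Set.Ioc (0:ℝ) 1) (t : ℝ) :
    quant m u ≤ t ↔ u ≤ cdf m t := by
  obtain ⟨h1, h2⟩ := quant_set hM hu
  constructor
  · intro h
    have hc : Tendsto (cdf m) (𝓝[>] t) (𝓝 (cdf m t)) :=
      continuousWithinAt_Ioi_iff_Ici.mpr ((cdf m).right_continuous t)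
    refine ge_of_tendsto hc ?_
    filter_upwards [self_mem_nhdsWithin] with y hy
    obtain ⟨z, hz, hzy⟩ := exists_lt_of_csInf_lt ⟨M, h1⟩ (lt_of_le_of_lt h hy)
    exact le_trans hz (monotone_cdf m hzy.le)
  · intro h
    exact csInf_le ⟨-M, h2⟩ h

theorem quant_mono (hM : m (Set.Icc (-M) M)ᶜ = 0) : MonotoneOn (quant m) (Set.Ioc 0 1) := by
  intro u hu v hv huv
  rw [quant_le_iff hM hu]
  exact huv.trans ((quant_le_iff hM hv _).1 le_rfl)

theorem quant_abs (hM : m (Set.Icc (-M) M)ᶜ = 0) {u : ℝ} (hu : u ∈ Set.Ioc (0:ℝ) 1) :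
    |quant m u| ≤ M := by
  obtain ⟨h1, h2⟩ := quant_set hM hu
  exact abs_le.2 ⟨le_csInf ⟨M, h1⟩ h2, csInf_le ⟨-M, h2⟩ h1⟩

theorem quant_map (hM : m (Set.Icc (-M) M)ᶜ = 0) (hmeas : Measurable fun a => quant m (hrep a)) :
    (volume : Measure UnitAddCircle).map (fun a => quant m (hrep a)) = m := by
  refine Measure.ext_of_Iic _ _ fun t => ?_
  rw [Measure.map_apply hmeas measurableSet_Iic, ← ofReal_cdf, ← hrep_vol (cdf_nonneg m t) (cdf_le_one m t)]
  congr 1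
  ext a
  exact quant_le_iff hM (hrep_mem a) t
end quant

theorem quant_measurable {E : Type*} [MeasurableSpace E] (κ : Kernel E ℝ) [IsMarkovKernel κ] {M : ℝ}
    (hM : ∀ x, κ x (Set.Icc (-M) M)ᶜ = 0) :
    Measurable fun p : E × UnitAddCircle => quant (κ p.1) (hrep p.2) := by
  refine measurable_of_Iic fun t => ?_
  have : (fun p : E × UnitAddCircle => quant (κ p.1) (hrep p.2)) ⁻¹' Set.Iic t =
      {p | hrep p.2 ≤ (κ p.1 (Set.Iic t)).toReal} := by
    ext p
    have := quant_le_iff (hM p.1) (hrep_mem p.2) t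
    rw [cdf_eq_real] at this
    exact this
  rw [this]
  refine measurableSet_le (hrep_measurable.comp measurable_snd) ?_
  have := κ.measurable_coe (measurableSet_Iic (a := t))
  exact (this.comp measurable_fst).ennreal_toReal

set_option maxHeartbeats 400000 in
theorem rho_kernel_le {Ω : Type*} [MeasurableSpace Ω] [StandardBorelSpace Ω]
    (P : Measure Ω) [IsProbabilityMeasure P] [NullSingletonClass P]
    (ρ : (Ω → ℝ) → ℝ) (hρ : IsRiskMeasure P ρ) (hLI : LawInvariant P ρ)
    {E F : Type*} [MeasurableSpace E] [StandardBorelSpace E] [MeasurableSpace F]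
    [StandardBorelSpace F] (K : Kernel E F) [IsMarkovKernel K]
    (μ : Measure E) [IsProbabilityMeasure μ] (g : F → ℝ) (hg : BddMeas g) :
    BddMeas (fun x => ∫ y, g y ∂(K x)) ∧
    rhoMu P ρ μ (fun x => ∫ y, g y ∂(K x)) ≤ rhoMu P ρ (μ.bind K) g := by
  obtain ⟨hgm, M, hM⟩ := id hg
  have hf : BddMeas (fun x => ∫ y, g y ∂(K x)) := by
    refine ⟨(hgm.stronglyMeasurable.integral_kernel).measurable, M, fun x => ?_⟩
    have := norm_integral_le_of_norm_le_const (μ := K x) (f := g) (C := M)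
      (Filter.Eventually.of_forall hM)
    simpa using this
  refine ⟨hf, ?_⟩
  have : IsProbabilityMeasure (volume : Measure UnitAddCircle) := ⟨by simp⟩
  have hκ : IsMarkovKernel (K.map g) := Kernel.IsMarkovKernel.map K hgm
  set κ := K.map g with hκdef
  have hκM : ∀ x, κ x (Set.Icc (-M) M)ᶜ = 0 := by
    intro x
    rw [hκdef, Kernel.map_apply' _ hgm _ measurableSet_Icc.compl]
    have : g ⁻¹' (Set.Icc (-M) M)ᶜ = ∅ := by
      ext y; simpa using abs_le.1 (hM y)
    rw [this]; simp
  have hQ := quant_measurable κ hκM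
  have hQx : ∀ x, Measurable fun a => quant (κ x) (hrep a) := fun x =>
    hQ.comp (measurable_const.prodMk measurable_id)
  have hQM : ∀ x a, |quant (κ x) (hrep a)| ≤ M := fun x a => quant_abs (hκM x) (hrep_mem a)
  -- the integral
  have hint : ∀ x, ∫ y, g y ∂(K x) = ∫ a, quant (κ x) (hrep a) := by
    intro x
    have h1 : ∫ t, t ∂(κ x) = ∫ y, g y ∂(K x) := by
      rw [hκdef, Kernel.map_apply _ hgm, integral_map hgm.aemeasurable (by fun_prop)]
    rw [← h1]
    conv_lhs => rw [← quant_map (hκM x) (hQx x)]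
    rw [integral_map (hQx x).aemeasurable (by fun_prop)]
  have hest : ∀ (n : ℕ) x b, ∫ y, g y ∂(K x) ≤
      circSum (quant (κ x)) n b / (n+1) + 2 * M / (n+1) := by
    intro n x b
    have hpos : (0:ℝ) < n + 1 := by positivity
    rw [← add_div, le_div_iff₀ hpos, hint]
    have hii : ∀ c : UnitAddCircle, Integrable (fun a => quant (κ x) (hrep (a + c))) volume := by
      intro c
      refine Integrable.of_bound (C := M) ?_ (Filter.Eventually.of_forall fun a => hQM x (a + c))
      exact ((hQx x).comp (measurable_add_const c)).aestronglyMeasurable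
    have h2 : ∫ a, circSum (quant (κ x)) n a = (∫ a, quant (κ x) (hrep a)) * (n+1) := by
      unfold circSum
      rw [integral_finsetSum _ fun i _ => hii _]
      have : ∀ c : UnitAddCircle, ∫ a, quant (κ x) (hrep (a + c)) = ∫ a, quant (κ x) (hrep a) :=
        fun c => integral_add_right_eq_self (fun a => quant (κ x) (hrep a)) c
      simp_rw [this]
      simp; ring
    rw [← h2]
    have h3 : ∫ a, circSum (quant (κ x)) n a ≤
        ∫ _a : UnitAddCircle, (circSum (quant (κ x)) n b + 2 * M) := by
      refine integral_mono ?_ (integrable_const _) fun a => 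
        circSum_le (quant_mono (hκM x)) (fun u hu => quant_abs (hκM x) hu) n a b
      exact integrable_finsetSum _ fun i _ => hii _
    simpa using h3
  -- random variables
  obtain ⟨W, hW, hWP⟩ := exists_law P (μ.prod (volume : Measure UnitAddCircle))
  have hX : P.map (fun ω => (W ω).1) = μ := by
    have : P.map (Prod.fst ∘ W) = μ := by
      rw [← Measure.map_map measurable_fst hW, hWP]
      simp
    exact this
  have hKp : IsProbabilityMeasure (μ.bind K) := inferInstance
  obtain ⟨Y, hY, hYP⟩ := exists_law P (μ.bind K)
  rw [rhoMu_eq hLI hf hW.fst hX, rhoMu_eq hLI hg hY hYP]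
  obtain ⟨q, hqdef⟩ : ∃ q : E × UnitAddCircle → ℝ, q = fun p => quant (κ p.1) (hrep p.2) := ⟨_, rfl⟩
  have hqa : ∀ x a, q (x, a) = quant (κ x) (hrep a) := fun x a => by rw [hqdef]
  rw [← hqdef] at hQ
  have hqM : ∀ p, |q p| ≤ M := fun p => by
    have := hQM p.1 p.2
    rwa [← hqa] at this
  have hsh : ∀ c : UnitAddCircle,
      Measurable (fun p : E × UnitAddCircle => (p.1, p.2 + c)) := fun c =>
    measurable_fst.prodMk ((measurable_add_const c).comp measurable_snd)
  obtain ⟨sh, hshdef⟩ : ∃ sh : UnitAddCircle → E × UnitAddCircle → E × UnitAddCircle,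
      sh = fun c p => (p.1, p.2 + c) := ⟨_, rfl⟩
  have hshm : ∀ c, Measurable (sh c) := fun c => by rw [hshdef]; exact hsh c
  have hZm : ∀ c, Measurable (q ∘ (sh c ∘ W)) := fun c => hQ.comp ((hshm c).comp hW)
  have hlaw : ∀ c, ρ (q ∘ (sh c ∘ W)) = ρ (g ∘ Y) := by
    intro c
    refine hLI _ _ ⟨hZm c, M, fun ω => hqM _⟩ (hg.comp hY) ?_
    have e2 : (μ.prod (volume : Measure UnitAddCircle)).map (sh c) = μ.prod volume := by
      rw [hshdef]
      exact ((MeasurePreserving.id μ).prod (measurePreserving_add_right volume c)).map_eq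
    rw [← Measure.map_map hQ ((hshm c).comp hW), ← Measure.map_map (hshm c) hW, hWP, e2,
      ← Measure.map_map hgm hY, hYP]
    ext s hs
    rw [Measure.map_apply hQ hs, Measure.map_apply hgm hs, Measure.prod_apply (hQ hs),
      Measure.bind_apply (hgm hs) K.measurable.aemeasurable]
    refine lintegral_congr fun x => ?_
    have h5 := congrArg (fun m : Measure ℝ => m s) (quant_map (hκM x) (hQx x))
    rw [Measure.map_apply (hQx x) hs, hκdef, Kernel.map_apply' _ hgm _ hs, ← hκdef] at h5
    rw [← h5]
    congr 1
    ext a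
    simp only [Set.mem_preimage, hqa]
  have hmain : ∀ n : ℕ, ρ ((fun x => ∫ y, g y ∂(K x)) ∘ fun ω => (W ω).1) ≤
      ρ (g ∘ Y) + 2 * M / (n+1) := by
    intro n
    obtain ⟨hB, hA⟩ := rho_avg hρ (M := M)
      (fun i : ℕ => q ∘ (sh (((i:ℝ) / (n+1) : ℝ) : UnitAddCircle) ∘ W)) (fun i => hZm _)
      (fun i ω => hqM _) (ρ (g ∘ Y)) (fun i => (hlaw _).le) n
    have hc := hρ.cash _ (2 * M / (n+1)) hB
    refine le_trans (hρ.mono _ _ (hf.comp hW.fst) ?_ (Filter.Eventually.of_forall fun ω => ?_))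
      (hc.le.trans (by linarith))
    · obtain ⟨hB1, C, hC⟩ := hB
      refine ⟨hB1.add_const _, C + |2 * M / (n+1)|, fun ω => ?_⟩
      exact (abs_add_le _ _).trans (by have := hC ω; simp only at this; gcongr)
    · have h6 := hest n (W ω).1 (W ω).2
      simp only [circSum] at h6
      simp only [Function.comp_apply, hshdef, hqa]
      exact h6
  have hlim : Tendsto (fun n : ℕ => ρ (g ∘ Y) + 2 * M / ((n:ℝ)+1)) atTop (𝓝 (ρ (g ∘ Y) + 0)) := by
    refine Tendsto.const_add _ ?_
    have := (tendsto_one_div_add_atTop_nhds_zero_nat (𝕜 := ℝ)).const_mul (2 * M)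
    simpa [div_eq_mul_inv] using this
  rw [add_zero] at hlim
  exact ge_of_tendsto' hlim hmain

theorem divergence_kernel_le {Ω : Type*} [MeasurableSpace Ω] [StandardBorelSpace Ω]
    (P : Measure Ω) [IsProbabilityMeasure P] [NullSingletonClass P]
    (ρ : (Ω → ℝ) → ℝ) (hρ : IsRiskMeasure P ρ) (hLI : LawInvariant P ρ)
    {E F : Type*} [MeasurableSpace E] [StandardBorelSpace E] [MeasurableSpace F]
    [StandardBorelSpace F] (K : Kernel E F) [IsMarkovKernel K]
    (μ ν : Measure E) [IsProbabilityMeasure μ] [IsProbabilityMeasure ν] :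
    divergence P ρ (ν.bind K) (μ.bind K) ≤ divergence P ρ ν μ := by
  refine iSup₂_le fun g hg => ?_
  obtain ⟨hf, hle⟩ := rho_kernel_le P ρ hρ hLI K μ g hg
  refine le_trans (ENNReal.ofReal_le_ofReal ?_)
    (le_iSup₂ (f := fun (f : E → ℝ) (_ : BddMeas f) =>
      ENNReal.ofReal ((∫ x, f x ∂ν) - rhoMu P ρ μ f)) _ hf)
  have hi : Integrable g (ν.bind K) := by
    obtain ⟨hgm, M, hM⟩ := hg
    exact Integrable.of_bound (C := M) hgm.aestronglyMeasurable (Filter.Eventually.of_forall hM)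
  have : ∫ y, g y ∂(ν.bind K) = ∫ x, ∫ y, g y ∂(K x) ∂ν := by
    have h : (K ∘ₖ Kernel.const Unit ν) () = ν.bind K := by
      rw [Kernel.comp_apply, Kernel.const_apply]
    rw [← h] at hi ⊢
    rw [Kernel.integral_comp hi, Kernel.const_apply]
  rw [this]
  linarith

theorem divergence_map_le {Ω : Type*} [MeasurableSpace Ω] [StandardBorelSpace Ω]
    (P : Measure Ω) [IsProbabilityMeasure P] [NullSingletonClass P]
    (ρ : (Ω → ℝ) → ℝ) (hρ : IsRiskMeasure P ρ) (hLI : LawInvariant P ρ)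
    {E F : Type*} [MeasurableSpace E] [StandardBorelSpace E] [MeasurableSpace F]
    [StandardBorelSpace F] {T : E → F} (hT : Measurable T)
    (μ ν : Measure E) [IsProbabilityMeasure μ] [IsProbabilityMeasure ν] :
    divergence P ρ (ν.map T) (μ.map T) ≤ divergence P ρ ν μ := by
  have := divergence_kernel_le P ρ hρ hLI (Kernel.deterministic T hT) μ ν
  rwa [Measure.deterministic_comp_eq_map hT, Measure.deterministic_comp_eq_map hT] at this

/-- Data processing inequality for the divergence induced by a law invariant
risk measure: `α(νK | μK) ≤ α(ν | μ)` for any Markov kernel `K`; in particular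
`α(ν∘T⁻¹ | μ∘T⁻¹) ≤ α(ν | μ)` for measurable `T`, with equality when `T` is a bijection with
measurable inverse. -/
theorem statement1 {Ω : Type*} [MeasurableSpace Ω] [StandardBorelSpace Ω]
    (P : Measure Ω) [IsProbabilityMeasure P] [NullSingletonClass P]
    (ρ : (Ω → ℝ) → ℝ) (hρ : IsRiskMeasure P ρ) (hLI : LawInvariant P ρ)
    (E : Type) [TopologicalSpace E] [MeasurableSpace E] [PolishSpace E] [BorelSpace E]
    (F : Type) [TopologicalSpace F] [MeasurableSpace F] [PolishSpace F] [BorelSpace F]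
    (K : Kernel E F) [IsMarkovKernel K]
    (μ ν : Measure E) [IsProbabilityMeasure μ] [IsProbabilityMeasure ν] :
    divergence P ρ (ν.bind (fun x => K x)) (μ.bind (fun x => K x)) ≤ divergence P ρ ν μ ∧
    (∀ T : E → F, Measurable T →
      divergence P ρ (ν.map T) (μ.map T) ≤ divergence P ρ ν μ) ∧
    (∀ T : E → F, Measurable T → ∀ S : F → E, Measurable S →
      Function.LeftInverse S T → Function.RightInverse S T →
      divergence P ρ (ν.map T) (μ.map T) = divergence P ρ ν μ) := by
  refine ⟨divergence_kernel_le P ρ hρ hLI K μ ν,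
    fun T hT => divergence_map_le P ρ hρ hLI hT μ ν, fun T hT S hS h1 h2 => ?_⟩
  refine le_antisymm (divergence_map_le P ρ hρ hLI hT μ ν) ?_
  have : IsProbabilityMeasure (μ.map T) := Measure.isProbabilityMeasure_map hT.aemeasurable
  have : IsProbabilityMeasure (ν.map T) := Measure.isProbabilityMeasure_map hT.aemeasurable
  have h := divergence_map_le P ρ hρ hLI hS (μ.map T) (ν.map T)
  rwa [Measure.map_map hS hT, Measure.map_map hS hT, h1.comp_eq_id, Measure.map_id,
    Measure.map_id] at h

end RiskDiv
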